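/- Let V₁, V₂, V₃ be finite-dimensional vector spaces and v ∈ V₁ ⊗ V₂ ⊗ V₃. Then the minimal subspace of v with respect to the pair of factors (1,2), U_{12}^min(v) ⊆ V₁ ⊗ V₂, is contained in U₁^min(v) ⊗ U₂^min(v). -/

import Mathlib

open TensorProduct

namespace TensorProduct

section Contraction

variable {k V V' W W' : Type*} [Field k] [AddCommGroup V] [Module k V]
  [AddCommGroup V'] [Module k V'] [AddCommGroup W] [Module k W] [AddCommGroup W'] [Module k W']

/-- Contraction of the right tensor factor with a linear functional. -/
noncomputable def contractRightFactor (φ : W →ₗ[k] k) : V ⊗[k] W →ₗ[k] V :=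
  (TensorProduct.rid k V).toLinearMap ∘ₗ φ.lTensor V

@[simp]
theorem contractRightFactor_tmul (φ : W →ₗ[k] k) (x : V) (y : W) :
    contractRightFactor φ (x ⊗ₜ[k] y) = φ y • x := by
  simp [contractRightFactor]

theorem contractRightFactor_map_id (φ : W →ₗ[k] k) (f : V →ₗ[k] V') (z : V ⊗[k] W) :
    contractRightFactor φ (map f LinearMap.id z) = f (contractRightFactor φ z) := by
  induction z with
  | zero => simp
  | tmul x y => simp
  | add a b ha hb => simp [ha, hb]

theorem sum_contractRightFactor_coord_tmul {ι : Type*} [Fintype ι] (b : Module.Basis ι k W)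
    (w : V ⊗[k] W) : ∑ i, contractRightFactor (b.coord i) w ⊗ₜ[k] b i = w := by
  induction w with
  | zero => simp
  | tmul x y =>
    simp only [contractRightFactor_tmul, smul_tmul, ← tmul_sum, Module.Basis.coord_apply,
      b.sum_repr]
  | add a b ha hb => simp only [map_add, add_tmul, Finset.sum_add_distrib, ha, hb]

theorem mem_range_map_subtype_id_iff [FiniteDimensional k W] (U : Submodule k V) (w : V ⊗[k] W) :
    w ∈ LinearMap.range (map U.subtype (LinearMap.id : W →ₗ[k] W)) ↔
      ∀ φ : W →ₗ[k] k, contractRightFactor φ w ∈ U := by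
  constructor
  · rintro ⟨z, rfl⟩ φ
    rw [contractRightFactor_map_id]
    exact (contractRightFactor φ z).2
  · intro h
    rw [← sum_contractRightFactor_coord_tmul (Module.finBasis k W) w]
    exact Submodule.sum_mem _ fun i _ ↦
      ⟨(⟨_, h ((Module.finBasis k W).coord i)⟩ : U) ⊗ₜ Module.finBasis k W i, by simp⟩

theorem mem_range_map_comm_iff (f : V →ₗ[k] V') (g : W →ₗ[k] W') (w : V' ⊗[k] W') :
    TensorProduct.comm k V' W' w ∈ LinearMap.range (map g f) ↔ w ∈ LinearMap.range (map f g) := by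
  constructor
  · rintro ⟨z, hz⟩
    refine ⟨TensorProduct.comm k W V z, ?_⟩
    rw [map_comm, hz, ← TensorProduct.comm_symm, LinearEquiv.symm_apply_apply]
  · rintro ⟨z, rfl⟩
    exact ⟨TensorProduct.comm k V W z, map_comm g f z⟩

theorem mem_range_map_sInf_subtype_id [FiniteDimensional k W] {S : Set (Submodule k V)}
    {w : V ⊗[k] W}
    (h : ∀ U ∈ S, w ∈ LinearMap.range (map U.subtype (LinearMap.id : W →ₗ[k] W))) :
    w ∈ LinearMap.range (map (sInf S).subtype (LinearMap.id : W →ₗ[k] W)) := by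
  simp only [mem_range_map_subtype_id_iff, Submodule.mem_sInf] at h ⊢
  exact fun φ U hU ↦ h U hU φ

theorem mem_range_map_id_sInf_subtype [FiniteDimensional k V] {S : Set (Submodule k W)}
    {w : V ⊗[k] W}
    (h : ∀ U ∈ S, w ∈ LinearMap.range (map (LinearMap.id : V →ₗ[k] V) U.subtype)) :
    w ∈ LinearMap.range (map (LinearMap.id : V →ₗ[k] V) (sInf S).subtype) := by
  rw [← mem_range_map_comm_iff]
  exact mem_range_map_sInf_subtype_id fun U hU ↦ (mem_range_map_comm_iff _ _ _).2 (h U hU)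

theorem mem_range_map_subtype_subtype {A : Submodule k V} {B : Submodule k W} {w : V ⊗[k] W}
    (hA : w ∈ LinearMap.range (map A.subtype (LinearMap.id : W →ₗ[k] W)))
    (hB : w ∈ LinearMap.range (map (LinearMap.id : V →ₗ[k] V) B.subtype)) :
    w ∈ LinearMap.range (map A.subtype B.subtype) := by
  obtain ⟨p, hp⟩ := A.subtype.exists_leftInverse_of_injective A.ker_subtype
  obtain ⟨x, rfl⟩ := hB
  obtain ⟨y, hy⟩ := hA
  refine ⟨map p LinearMap.id x, ?_⟩
  calc map A.subtype B.subtype (map p LinearMap.id x)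
      = map (A.subtype ∘ₗ p) LinearMap.id (map LinearMap.id B.subtype x) := by
        simp only [← LinearMap.comp_apply, ← map_comp, LinearMap.comp_id, LinearMap.id_comp]
    _ = map LinearMap.id B.subtype x := by
        rw [← hy, ← LinearMap.comp_apply, ← map_comp, LinearMap.comp_assoc, hp,
          LinearMap.comp_id, LinearMap.comp_id]

theorem contractRightFactor_mem_range (φ : W →ₗ[k] k) (f : V →ₗ[k] V') {w : V' ⊗[k] W}
    (h : w ∈ LinearMap.range (map f (LinearMap.id : W →ₗ[k] W))) :
    contractRightFactor φ w ∈ LinearMap.range f := by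
  obtain ⟨z, rfl⟩ := h
  exact ⟨_, (contractRightFactor_map_id φ f z).symm⟩

end Contraction

end TensorProduct

/-- For `v ∈ V₁ ⊗ V₂ ⊗ V₃` (finite-dimensional), the minimal subspace `U_{12}^min(v)` of
`V₁ ⊗ V₂` is contained in `U₁^min(v) ⊗ U₂^min(v)` (via the canonical embedding). -/
theorem stmt8 (k V₁ V₂ V₃ : Type*) [Field k]
    [AddCommGroup V₁] [Module k V₁] [AddCommGroup V₂] [Module k V₂]
    [AddCommGroup V₃] [Module k V₃]
    [FiniteDimensional k V₁] [FiniteDimensional k V₂] [FiniteDimensional k V₃]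
    (v : (V₁ ⊗[k] V₂) ⊗[k] V₃) :
    sInf {U : Submodule k (V₁ ⊗[k] V₂) |
        v ∈ LinearMap.range (TensorProduct.map U.subtype (LinearMap.id : V₃ →ₗ[k] V₃))}
    ≤ LinearMap.range (TensorProduct.map
        (sInf {U : Submodule k V₁ | v ∈ LinearMap.range (TensorProduct.map
          (TensorProduct.map U.subtype (LinearMap.id : V₂ →ₗ[k] V₂))
          (LinearMap.id : V₃ →ₗ[k] V₃))}).subtype
        (sInf {U : Submodule k V₂ | v ∈ LinearMap.range (TensorProduct.map
          (TensorProduct.map (LinearMap.id : V₁ →ₗ[k] V₁) U.subtype)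
          (LinearMap.id : V₃ →ₗ[k] V₃))}).subtype) := by
  refine sInf_le ((mem_range_map_subtype_id_iff _ v).2 fun φ ↦ ?_)
  exact mem_range_map_subtype_subtype
    (mem_range_map_sInf_subtype_id fun _ hU ↦ contractRightFactor_mem_range φ _ hU)
    (mem_range_map_id_sInf_subtype fun _ hU ↦ contractRightFactor_mem_range φ _ hU)
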